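/- Let F be a field with |F| ≥ 3 and let l¹, l², l³ be pairwise disjoint lines in F³. Then there exists a non-zero polynomial Q ∈ F[x, y, z] of total degree at most 2 which vanishes identically on l¹ ∪ l² ∪ l³, and moreover every line l in F³ that intersects each of l¹, l², l³ is entirely contained in the zero set {(x,y,z) ∈ F³ : Q(x,y,z) = 0}. -/

import Mathlib

/-- A line in `F³`: the set `{x + t • v : t ∈ F}` for some point `x` and
some non-zero direction `v`. -/
def IsSpaceLine (F : Type*) [Field F] (l : Set (Fin 3 → F)) : Prop :=
  ∃ x v : Fin 3 → F, v ≠ 0 ∧ l = {y | ∃ t : F, y = x + t • v}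

open MvPolynomial in
/-- A polynomial of total degree at most two with three distinct zeros on a line vanishes on it. -/
theorem IsSpaceLine.eval_eq_zero {F : Type*} [Field F] {l : Set (Fin 3 → F)}
    (hl : IsSpaceLine F l) {Q : MvPolynomial (Fin 3) F} (hQ : Q.totalDegree ≤ 2)
    {f : Fin 3 → Fin 3 → F} (hf : Function.Injective f) (hfl : ∀ i, f i ∈ l)
    (hf0 : ∀ i, eval (f i) Q = 0) {p : Fin 3 → F} (hp : p ∈ l) : eval p Q = 0 := by
  obtain ⟨x, v, -, rfl⟩ := hl
  choose t ht using hfl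
  have ht_inj : Function.Injective t := fun i j h ↦ hf (by rw [ht i, ht j, h])
  let g : Fin 3 → Polynomial F := fun i ↦ Polynomial.C (v i) * Polynomial.X + Polynomial.C (x i)
  have heval (s : F) : (aeval g Q).eval s = eval (x + s • v) Q := by
    rw [← Polynomial.coe_aeval_eq_eval, comp_aeval_apply, ← coe_aeval_eq_eval, RingHom.coe_coe]
    congr 2
    funext i
    simp [g]
    ring
  have hdeg : (aeval g Q).natDegree ≤ 2 * 1 :=
    aeval_natDegree_le Q hQ g fun i ↦ Polynomial.natDegree_linear_le
  have hzero : aeval g Q = 0 := by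
    refine Polynomial.eq_zero_of_natDegree_lt_card_of_eval_eq_zero _ ht_inj (fun i ↦ ?_) ?_
    · rw [heval, ← ht, hf0]
    · rw [Fintype.card_fin]
      omega
  obtain ⟨s, rfl⟩ := hp
  rw [← heval, hzero, Polynomial.eval_zero]

/-- Over a field with at least three elements, a line contains three distinct points. -/
theorem IsSpaceLine.exists_injective {F : Type*} [Field F] {l : Set (Fin 3 → F)}
    (hl : IsSpaceLine F l) (hF : ∃ a b c : F, a ≠ b ∧ a ≠ c ∧ b ≠ c) :
    ∃ f : Fin 3 → Fin 3 → F, Function.Injective f ∧ ∀ i, f i ∈ l := by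
  obtain ⟨a, b, c, hab, hac, hbc⟩ := hF
  obtain ⟨x, v, hv, rfl⟩ := hl
  have hinj : Function.Injective ![a, b, c] := by
    simp [Function.Injective, Fin.forall_fin_succ, hab, hac, hbc, hab.symm, hac.symm, hbc.symm]
  exact ⟨fun i ↦ x + ![a, b, c] i • v,
    fun i j h ↦ hinj (smul_left_injective F hv (add_left_cancel h)), fun i ↦ ⟨_, rfl⟩⟩

/-- The exponents of the ten monomials of degree at most two in three variables. -/
noncomputable def quadricExponent (i : Fin 10) : Fin 3 →₀ ℕ :=
  Finsupp.equivFunOnFinite.symm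
    (![![0, 0, 0], ![1, 0, 0], ![0, 1, 0], ![0, 0, 1], ![2, 0, 0], ![0, 2, 0], ![0, 0, 2],
      ![1, 1, 0], ![1, 0, 1], ![0, 1, 1]] i)

theorem quadricExponent_injective : Function.Injective quadricExponent :=
  Finsupp.equivFunOnFinite.symm.injective.comp (by decide)

theorem degree_quadricExponent_le (i : Fin 10) : (quadricExponent i).degree ≤ 2 := by
  rw [Finsupp.degree_eq_sum]
  revert i
  simp only [quadricExponent, Finsupp.equivFunOnFinite_symm_apply_apply]
  decide

open MvPolynomial in
/-- Any nine points of `F³` lie on a common quadric. -/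
theorem exists_quadric_through {F ι : Type*} [Field F] [Fintype ι] (hι : Fintype.card ι < 10)
    (f : ι → Fin 3 → F) :
    ∃ Q : MvPolynomial (Fin 3) F, Q ≠ 0 ∧ Q.totalDegree ≤ 2 ∧ ∀ i, eval (f i) Q = 0 := by
  let φ : (Fin 10 → F) →ₗ[F] MvPolynomial (Fin 3) F :=
    ∑ j, monomial (quadricExponent j) ∘ₗ LinearMap.proj j
  have hφ (c : Fin 10 → F) : φ c = ∑ j, monomial (quadricExponent j) (c j) := by simp [φ]
  let ψ : (Fin 10 → F) →ₗ[F] ι → F :=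
    LinearMap.pi fun i ↦ (aeval (f i)).toLinearMap ∘ₗ φ
  obtain ⟨c, hc, hc0⟩ := (Submodule.ne_bot_iff _).1
    (LinearMap.ker_ne_bot_of_finrank_lt (f := ψ) (by simpa using hι))
  refine ⟨φ c, fun h ↦ hc0 (funext fun k ↦ ?_), ?_, fun i ↦ congrFun (LinearMap.mem_ker.1 hc) i⟩
  · simpa [hφ, coeff_sum, coeff_monomial, quadricExponent_injective.eq_iff] using
      congrArg (coeff (quadricExponent k)) h
  · rw [hφ]
    refine totalDegree_finsetSum_le fun j _ ↦ (totalDegree_monomial_le _ _).trans ?_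
    exact degree_quadricExponent_le j

theorem regulus_quadric {F : Type*} [Field F]
    (hF : ∃ a b c : F, a ≠ b ∧ a ≠ c ∧ b ≠ c)
    (l₁ l₂ l₃ : Set (Fin 3 → F))
    (h₁ : IsSpaceLine F l₁) (h₂ : IsSpaceLine F l₂) (h₃ : IsSpaceLine F l₃)
    (h₁₂ : Disjoint l₁ l₂) (h₁₃ : Disjoint l₁ l₃) (h₂₃ : Disjoint l₂ l₃) :
    ∃ Q : MvPolynomial (Fin 3) F, Q ≠ 0 ∧ Q.totalDegree ≤ 2 ∧
      (∀ p ∈ l₁ ∪ l₂ ∪ l₃, MvPolynomial.eval p Q = 0) ∧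
      ∀ l : Set (Fin 3 → F), IsSpaceLine F l →
        (l ∩ l₁).Nonempty → (l ∩ l₂).Nonempty → (l ∩ l₃).Nonempty →
        ∀ p ∈ l, MvPolynomial.eval p Q = 0 := by
  obtain ⟨f₁, hf₁, hfl₁⟩ := h₁.exists_injective hF
  obtain ⟨f₂, hf₂, hfl₂⟩ := h₂.exists_injective hF
  obtain ⟨f₃, hf₃, hfl₃⟩ := h₃.exists_injective hF
  obtain ⟨Q, hQ, hdeg, hzero⟩ := exists_quadric_through
    (ι := Fin 3 ⊕ Fin 3 ⊕ Fin 3) (by simp) (Sum.elim f₁ (Sum.elim f₂ f₃))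
  simp only [Sum.forall, Sum.elim_inl, Sum.elim_inr] at hzero
  have hQ₁ : ∀ p ∈ l₁, MvPolynomial.eval p Q = 0 :=
    fun p ↦ h₁.eval_eq_zero hdeg hf₁ hfl₁ hzero.1
  have hQ₂ : ∀ p ∈ l₂, MvPolynomial.eval p Q = 0 :=
    fun p ↦ h₂.eval_eq_zero hdeg hf₂ hfl₂ hzero.2.1
  have hQ₃ : ∀ p ∈ l₃, MvPolynomial.eval p Q = 0 :=
    fun p ↦ h₃.eval_eq_zero hdeg hf₃ hfl₃ hzero.2.2
  refine ⟨Q, hQ, hdeg, ?_, ?_⟩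
  · rintro p ((hp | hp) | hp)
    exacts [hQ₁ p hp, hQ₂ p hp, hQ₃ p hp]
  · rintro l hl ⟨p₁, hp₁, hpl₁⟩ ⟨p₂, hp₂, hpl₂⟩ ⟨p₃, hp₃, hpl₃⟩ p hp
    have n₁₂ := h₁₂.ne_of_mem hpl₁ hpl₂
    have n₁₃ := h₁₃.ne_of_mem hpl₁ hpl₃
    have n₂₃ := h₂₃.ne_of_mem hpl₂ hpl₃
    refine hl.eval_eq_zero hdeg (f := ![p₁, p₂, p₃]) ?_ ?_ ?_ hp
    · simp [Function.Injective, Fin.forall_fin_succ, n₁₂, n₁₃, n₂₃, n₁₂.symm, n₁₃.symm, n₂₃.symm]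
    · simp [Fin.forall_fin_succ, hp₁, hp₂, hp₃]
    · simp [Fin.forall_fin_succ, hQ₁ p₁ hpl₁, hQ₂ p₂ hpl₂, hQ₃ p₃ hpl₃]
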